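/- arXiv:2511.11461 — 2 statements merged into one kernel-verified Lean document; each statement's English description precedes it below -/
import Mathlib

section
/- The two-step composition map A : ℝ² → ℝ² defined by A(b₁, b₂) = (b₁² + b₂, b₁·b₂) is surjective: for every (φ₁, φ₂) ∈ ℝ² there exists (b₁, b₂) ∈ ℝ² with b₁² + b₂ = φ₁ and b₁·b₂ = φ₂. -/
/-- Every depressed real cubic `x³ - p x + q` has a real root. -/
theorem exists_root_depressed_cubic (p q : ℝ) : ∃ x : ℝ, x ^ 3 - p * x + q = 0 := by
  have bound : |q| ≤ (1 + |p| + |q|) ^ 3 - |p| * (1 + |p| + |q|) := by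
    have hp := abs_nonneg p
    have hq := abs_nonneg q
    have h : 0 ≤ |p| * |q| := mul_nonneg hp hq
    have hdiff : (1 + |p| + |q|) ^ 3 - |p| * (1 + |p| + |q|) - |q| =
        1 + 2 * |p| + 2 * |p| ^ 2 + 2 * |q| + 3 * |q| ^ 2 + 5 * (|p| * |q|) +
          (|p| + |q|) ^ 3 := by ring
    have : 0 ≤ (1 + |p| + |q|) ^ 3 - |p| * (1 + |p| + |q|) - |q| := by
      rw [hdiff]
      positivity
    linarith
  have hM : 0 ≤ 1 + |p| + |q| := by positivity
  have hpM := mul_le_mul_of_nonneg_right (le_abs_self p) hM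
  have hcont : Continuous fun x : ℝ => x ^ 3 - p * x + q := by fun_prop
  refine mem_range_of_exists_le_of_exists_ge hcont
    ⟨-(1 + |p| + |q|), ?_⟩ ⟨1 + |p| + |q|, ?_⟩
  · have hneg : (-(1 + |p| + |q|)) ^ 3 - p * -(1 + |p| + |q|) + q =
        -((1 + |p| + |q|) ^ 3 - p * (1 + |p| + |q|)) + q := by ring
    linarith [le_abs_self q]
  · linarith [neg_abs_le q]

/-- The two-step composition map `A(b₁, b₂) = (b₁² + b₂, b₁·b₂)` induced by recursively
composing a one-step linear predictor with itself is surjective on `ℝ²`. -/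
theorem two_step_linear_composition_surjective :
    ∀ φ₁ φ₂ : ℝ, ∃ b₁ b₂ : ℝ, b₁ ^ 2 + b₂ = φ₁ ∧ b₁ * b₂ = φ₂ := by
  intro φ₁ φ₂
  obtain ⟨x, hx⟩ := exists_root_depressed_cubic φ₁ φ₂
  exact ⟨x, φ₁ - x ^ 2, by ring, by linear_combination -hx⟩
end

section
/- There is no (b₁, b₂, b₃) ∈ ℝ³ such that the two-step recursively composed function F(y₁, y₀) = b₁·f(y₁, y₀) + b₂·y₁ + b₃·f(y₁, y₀)·y₁, where f(y₁, y₀) = b₁·y₁ + b₂·y₀ + b₃·y₁·y₀, equals the function (y₁, y₀) ↦ y₁·y₀ for all real y₁, y₀. Hence the direct two-step bilinear predictor with coefficients (c₁, c₂, c₃) = (0, 0, 1) is not representable by any recursive composition of a one-step bilinear predictor, so neither predictor class contains the other. -/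
/-- No recursive composition of a one-step bilinear predictor equals the direct two-step
bilinear predictor `(y₁, y₀) ↦ y₁·y₀` (coefficients `(0, 0, 1)`): neither predictor class
contains the other. -/
theorem direct_bilinear_not_recursive :
    ¬ ∃ b₁ b₂ b₃ : ℝ, ∀ y₁ y₀ : ℝ,
        b₁ * (b₁ * y₁ + b₂ * y₀ + b₃ * y₁ * y₀) + b₂ * y₁
          + b₃ * (b₁ * y₁ + b₂ * y₀ + b₃ * y₁ * y₀) * y₁
        = y₁ * y₀ := by
  rintro ⟨b₁, b₂, b₃, h⟩
  have h₃ : b₃ = 0 := by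
    have : b₃ ^ 2 = 0 := by
      linear_combination (h 1 1 + h (-1) 1 - h 1 0 - h (-1) 0) / 2 - h 0 1
    exact pow_eq_zero_iff two_ne_zero |>.mp this
  subst h₃
  have : (0 : ℝ) = 1 := by
    linear_combination h 1 1 - h 1 0 - h 0 1
  exact zero_ne_one this
end
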